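/- Let r ∈ {1, 2, 4} and let n be a positive integer with n ≡ 2r (mod 9). Then, as rational functions in the two variables a and q over ℚ, ∑_{k=0}^{n−1} (a^5 q^r; q^9)_k (q^r/a^5; q^9)_k (q^{9−2r}; q^9)_k · q^{9k} / ( (a q^9; q^9)_k (q^9/a; q^9)_k (q^9; q^9)_k ) ≡ 0 (mod (1 − a q^n)(a − q^n)). -/

import Mathlib

open Finset

/-- Polynomials in the two variables `a` (index 0) and `q` (index 1) over `ℚ`. -/
abbrev MvP : Type := MvPolynomial (Fin 2) ℚ

/-- The field of rational functions in the two variables `a` and `q` over `ℚ`. -/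
abbrev FF : Type := FractionRing MvP

/-- The variable `a`, viewed in the field of rational functions. -/
noncomputable def av : FF := algebraMap MvP FF (MvPolynomial.X 0)

/-- The variable `q`, viewed in the field of rational functions. -/
noncomputable def qv : FF := algebraMap MvP FF (MvPolynomial.X 1)

/-- The q-shifted factorial `(x; q)_k = ∏_{j=0}^{k-1} (1 - x q^j)`. -/
noncomputable def poch (x q : FF) (k : ℕ) : FF :=
  ∏ j ∈ Finset.range k, (1 - x * q ^ j)

/-- `A ≡ 0 (mod P)`: `A = P · (B / C)` where the denominator `C` is coprime
(has no common non-unit factor) with `P`. -/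
def CongrZero (A : FF) (P : MvP) : Prop :=
  ∃ B C : MvP, C ≠ 0 ∧ IsRelPrime C P ∧
    A = algebraMap MvP FF P * (algebraMap MvP FF B / algebraMap MvP FF C)

section QSeries

variable {K : Type*} [Field K]

/-- The q-shifted factorial over an arbitrary field. -/
def qPoch (x q : K) (k : ℕ) : K := ∏ j ∈ range k, (1 - x * q ^ j)

lemma qPoch_succ (x q : K) (k : ℕ) : qPoch x q (k + 1) = qPoch x q k * (1 - x * q ^ k) :=
  prod_range_succ _ _

lemma qPoch_add (x q : K) (m k : ℕ) :
    qPoch x q (m + k) = qPoch x q m * qPoch (x * q ^ m) q k := by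
  simp only [qPoch, prod_range_add, pow_add, mul_assoc]

lemma qPoch_succ' (x q : K) (k : ℕ) :
    qPoch x q (k + 1) = (1 - x) * qPoch (x * q) q k := by
  rw [add_comm, qPoch_add, pow_one]
  simp [qPoch]

lemma qPoch_ne_zero {x q : K} (h : ∀ j : ℕ, x * q ^ j ≠ 1) (k : ℕ) : qPoch x q k ≠ 0 :=
  prod_ne_zero_iff.2 fun j _ => sub_ne_zero.2 (h j).symm

lemma qPoch_eq_zero {x q : K} {j k : ℕ} (hj : j < k) (h : x * q ^ j = 1) : qPoch x q k = 0 :=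
  prod_eq_zero (mem_range.2 hj) (by rw [h, sub_self])

/-- A quotient of q-shifted factorials whose parameters differ by an integral power of `q`
is a polynomial in `q ^ k`. -/
lemma qPoch_div (x q : K) (h : ∀ j : ℕ, x * q ^ j ≠ 1) (m k : ℕ) :
    qPoch (x * q ^ m) q k / qPoch x q k = qPoch (x * q ^ k) q m / qPoch x q m := by
  rw [div_eq_div_iff (qPoch_ne_zero h k) (qPoch_ne_zero h m), mul_comm, ← qPoch_add, mul_comm,
    ← qPoch_add, add_comm]

/-- The terminating q-binomial theorem. -/
lemma sum_qPoch_neg_pow (q : K) (hq : q ≠ 0) (h1 : ∀ j : ℕ, q * q ^ j ≠ 1) (N : ℕ) (z : K) :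
    ∑ k ∈ range (N + 1), qPoch ((q ^ N)⁻¹) q k / qPoch q q k * z ^ k
      = qPoch (z * (q ^ N)⁻¹) q N := by
  induction N with
  | zero => simp [qPoch]
  | succ N ih =>
    have hrec : ∀ k, qPoch ((q ^ (N + 1))⁻¹) q (k + 1) / qPoch q q (k + 1)
        = qPoch ((q ^ N)⁻¹) q (k + 1) / qPoch q q (k + 1)
          - (q ^ (N + 1))⁻¹ * (qPoch ((q ^ N)⁻¹) q k / qPoch q q k) := by
      intro k
      have e : (q ^ (N + 1))⁻¹ * q = (q ^ N)⁻¹ := by field_simp; ring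
      have hk := qPoch_ne_zero h1 k
      have hk1 : 1 - q * q ^ k ≠ 0 := sub_ne_zero.2 (h1 k).symm
      rw [qPoch_succ' ((q ^ (N + 1))⁻¹), e, qPoch_succ q, qPoch_succ ((q ^ N)⁻¹)]
      field_simp
      ring
    have e : z * (q ^ (N + 1))⁻¹ * q = z * (q ^ N)⁻¹ := by field_simp; ring
    have h0 : qPoch ((q ^ N)⁻¹) q (N + 1) = 0 :=
      qPoch_eq_zero (Nat.lt_succ_self N) (inv_mul_cancel₀ (pow_ne_zero _ hq))
    have hext : ∑ k ∈ range (N + 2), qPoch ((q ^ N)⁻¹) q k / qPoch q q k * z ^ k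
        = qPoch (z * (q ^ N)⁻¹) q N := by
      rw [sum_range_succ, ih, h0]
      simp
    rw [qPoch_succ', e, sub_mul, one_mul]
    nth_rewrite 1 [← hext]
    rw [← ih, sum_range_succ', sum_range_succ' _ (N + 1), mul_sum,
      sum_congr rfl fun k _ => by rw [hrec k, sub_mul], sum_sub_distrib]
    have hshift : ∑ k ∈ range (N + 1),
        (q ^ (N + 1))⁻¹ * (qPoch ((q ^ N)⁻¹) q k / qPoch q q k) * z ^ (k + 1)
        = ∑ k ∈ range (N + 1),
        z * (q ^ (N + 1))⁻¹ * (qPoch ((q ^ N)⁻¹) q k / qPoch q q k * z ^ k) :=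
      sum_congr rfl fun k _ => by ring
    rw [hshift]
    simp [qPoch]
    ring

lemma sum_qPoch_neg_mul_eval (q : K) (hq : q ≠ 0) (h1 : ∀ j : ℕ, q * q ^ j ≠ 1) {N n : ℕ}
    (hn : N < n) (p : Polynomial K) (hp : p.natDegree < N) :
    ∑ k ∈ range n, qPoch ((q ^ N)⁻¹) q k / qPoch q q k * q ^ k * p.eval (q ^ k) = 0 := by
  have hsub : range (N + 1) ⊆ range n := range_subset_range.2 hn
  rw [← sum_subset hsub]
  · simp only [p.eval_eq_sum_range' hp, mul_sum]
    rw [sum_comm]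
    refine sum_eq_zero fun i hi => ?_
    have hi := mem_range.1 hi
    have key := sum_qPoch_neg_pow q hq h1 N (q ^ (i + 1))
    rw [qPoch_eq_zero (j := N - 1 - i) (by omega)] at key
    · rw [← mul_zero (p.coeff i), ← key, mul_sum]
      exact sum_congr rfl fun k _ => by ring
    · have : N = (i + 1) + (N - 1 - i) := by omega
      rw [mul_right_comm, ← pow_add, ← this, mul_inv_cancel₀ (pow_ne_zero _ hq)]
  · intro k _ hk
    rw [qPoch_eq_zero (j := N) (by simpa using hk) (inv_mul_cancel₀ (pow_ne_zero _ hq))]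
    simp

lemma exists_poly_qPoch (x q : K) (m : ℕ) :
    ∃ p : Polynomial K, p.natDegree ≤ m ∧ ∀ y, p.eval y = qPoch (x * y) q m := by
  refine ⟨∏ j ∈ range m, (1 - Polynomial.C (x * q ^ j) * Polynomial.X), ?_, fun y => ?_⟩
  · refine (Polynomial.natDegree_prod_le _ _).trans ?_
    refine (sum_le_sum (g := fun _ => 1) fun j _ => ?_).trans (by simp)
    compute_degree
  · rw [Polynomial.eval_prod]
    exact prod_congr rfl fun j _ => by simp; ring

/-- A balanced terminating `₃φ₂` series whose numerator parameters exceed the denominator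
parameters by integral powers of `q` vanishes. -/
lemma sum_qPoch_balanced (q x y : K) (hq : q ≠ 0) (h1 : ∀ j : ℕ, q * q ^ j ≠ 1)
    (hx : ∀ j : ℕ, x * q ^ j ≠ 1) (hy : ∀ j : ℕ, y * q ^ j ≠ 1) {M L N n : ℕ}
    (hN : M + L < N) (hn : N < n) :
    ∑ k ∈ range n, qPoch (x * q ^ M) q k * qPoch ((q ^ N)⁻¹) q k * qPoch (y * q ^ L) q k * q ^ k
      / (qPoch x q k * qPoch y q k * qPoch q q k) = 0 := by
  obtain ⟨p, hp, hpe⟩ := exists_poly_qPoch x q M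
  obtain ⟨s, hs, hse⟩ := exists_poly_qPoch y q L
  have key := sum_qPoch_neg_mul_eval q hq h1 hn (p * s)
    ((Polynomial.natDegree_mul_le.trans (add_le_add hp hs)).trans_lt hN)
  rw [← mul_zero ((qPoch x q M)⁻¹ * (qPoch y q L)⁻¹), ← key, mul_sum]
  refine sum_congr rfl fun k _ => ?_
  rw [Polynomial.eval_mul, hpe, hse]
  calc _ = (qPoch (x * q ^ M) q k / qPoch x q k) * (qPoch (y * q ^ L) q k / qPoch y q k)
        * (qPoch ((q ^ N)⁻¹) q k / qPoch q q k * q ^ k) := by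
          simp only [div_eq_mul_inv, mul_inv]; ring
    _ = _ := by
      rw [qPoch_div x q hx, qPoch_div y q hy]
      simp only [div_eq_mul_inv]; ring

lemma sum_qPoch_specialized (t : K) (ht : ∀ z : ℤ, t ^ z = 1 → z = 0) (ht0 : t ≠ 0) (r L n : ℕ)
    (hr : r = 1 ∨ r = 2 ∨ r = 4) (hn : n = 9 * L + 2 * r) :
    ∑ k ∈ range n, qPoch (t ^ (5 * n) * t ^ r) (t ^ 9) k * qPoch (t ^ r * (t ^ (5 * n))⁻¹) (t ^ 9) k
        * qPoch (t ^ (9 - 2 * r)) (t ^ 9) k * t ^ (9 * k)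
      / (qPoch (t ^ n * t ^ 9) (t ^ 9) k * qPoch (t ^ 9 * (t ^ n)⁻¹) (t ^ 9) k
        * qPoch (t ^ 9) (t ^ 9) k) = 0 := by
  have key := sum_qPoch_balanced (t ^ 9) (t ^ n * t ^ 9) (t ^ 9 * (t ^ n)⁻¹) (pow_ne_zero _ ht0)
    (fun j h => by
      have := ht (9 + 9 * j) (by
        rw [← h, zpow_add₀ ht0, zpow_mul]; norm_cast)
      omega)
    (fun j h => by
      have := ht (n + 9 + 9 * j) (by
        rw [← h, zpow_add₀ ht0, zpow_add₀ ht0, zpow_mul]; norm_cast)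
      omega)
    (fun j h => by
      have := ht (9 - n + 9 * j) (by
        rw [← h, zpow_add₀ ht0, zpow_sub₀ ht0, zpow_mul, div_eq_mul_inv]; norm_cast)
      omega)
    (M := 4 * L + r - 1) (L := L) (N := 5 * L + r) (n := n) (by omega) (by omega)
  have e1 : t ^ n * t ^ 9 * (t ^ 9) ^ (4 * L + r - 1) = t ^ (5 * n) * t ^ r := by
    rw [← pow_mul, ← pow_add, ← pow_add, ← pow_add]
    congr 1
    omega
  have e2 : ((t ^ 9) ^ (5 * L + r))⁻¹ = t ^ r * (t ^ (5 * n))⁻¹ := by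
    have : 5 * n = 9 * (5 * L + r) + r := by omega
    rw [this, pow_add t _ r, pow_mul t 9 (5 * L + r), mul_inv ((t ^ 9) ^ (5 * L + r)),
      mul_left_comm, mul_inv_cancel₀ (pow_ne_zero _ ht0), mul_one]
  have e3 : t ^ 9 * (t ^ n)⁻¹ * (t ^ 9) ^ L = t ^ (9 - 2 * r) := by
    rw [mul_right_comm, mul_inv_eq_iff_eq_mul₀ (pow_ne_zero _ ht0), ← pow_mul, ← pow_add,
      ← pow_add]
    congr 1
    omega
  rw [e1, e2, e3] at key
  simpa only [pow_mul] using key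

end QSeries

section Specialization

variable {K : Type*} [Field K]

/-- The rational function `x` is regular at the point given by `φ`, with value `v` there. -/
def HasValue (φ : MvP →+* K) (x : FF) (v : K) : Prop :=
  ∃ N D : MvP, φ D ≠ 0 ∧ x * algebraMap MvP FF D = algebraMap MvP FF N ∧ φ N = v * φ D

variable {φ : MvP →+* K}

lemma hasValue_algebraMap (p : MvP) : HasValue φ (algebraMap MvP FF p) (φ p) :=
  ⟨p, 1, by simp, by simp, by simp⟩

lemma hasValue_one : HasValue φ 1 1 := by simpa using hasValue_algebraMap (φ := φ) 1

namespace HasValue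

variable {x y : FF} {v w : K}

lemma add (hx : HasValue φ x v) (hy : HasValue φ y w) : HasValue φ (x + y) (v + w) := by
  obtain ⟨N, D, hD, h, e⟩ := hx
  obtain ⟨N', D', hD', h', e'⟩ := hy
  refine ⟨N * D' + N' * D, D * D', by simp [hD, hD'], ?_, ?_⟩
  · simp only [map_add, map_mul, ← h, ← h']; ring
  · simp only [map_add, map_mul, e, e']; ring

lemma mul (hx : HasValue φ x v) (hy : HasValue φ y w) : HasValue φ (x * y) (v * w) := by
  obtain ⟨N, D, hD, h, e⟩ := hx
  obtain ⟨N', D', hD', h', e'⟩ := hy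
  refine ⟨N * N', D * D', by simp [hD, hD'], ?_, ?_⟩
  · simp only [map_mul, ← h, ← h']; ring
  · simp only [map_mul, e, e']; ring

lemma sub (hx : HasValue φ x v) (hy : HasValue φ y w) : HasValue φ (x - y) (v - w) := by
  have h := hx.add ((hasValue_algebraMap (φ := φ) (-1)).mul hy)
  simpa [sub_eq_add_neg] using h

lemma inv (hx : HasValue φ x v) (hv : v ≠ 0) : HasValue φ x⁻¹ v⁻¹ := by
  obtain ⟨N, D, hD, h, e⟩ := hx
  have hN : φ N ≠ 0 := by rw [e]; exact mul_ne_zero hv hD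
  have hN0 : algebraMap MvP FF N ≠ 0 := by
    rw [map_ne_zero_iff _ (IsFractionRing.injective MvP FF)]
    rintro rfl
    simp at hN
  have hx0 : x ≠ 0 := by
    rintro rfl
    exact hN0 (by rw [← h, zero_mul])
  refine ⟨D, N, hN, ?_, ?_⟩
  · rw [← h, inv_mul_cancel_left₀ hx0]
  · rw [e, inv_mul_cancel_left₀ hv]

lemma div (hx : HasValue φ x v) (hy : HasValue φ y w) (hw : w ≠ 0) :
    HasValue φ (x / y) (v / w) := by
  simpa only [div_eq_mul_inv] using hx.mul (hy.inv hw)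

lemma pow (hx : HasValue φ x v) (k : ℕ) : HasValue φ (x ^ k) (v ^ k) := by
  induction k with
  | zero => simpa using hasValue_one
  | succ k ih => simpa only [pow_succ] using ih.mul hx

lemma sum {f : ℕ → FF} {g : ℕ → K} (h : ∀ k, HasValue φ (f k) (g k)) (n : ℕ) :
    HasValue φ (∑ k ∈ range n, f k) (∑ k ∈ range n, g k) := by
  induction n with
  | zero => simpa using hasValue_algebraMap (φ := φ) 0
  | succ k ih => simpa only [sum_range_succ] using ih.add (h k)

lemma poch (hx : HasValue φ x v) (hy : HasValue φ y w) (k : ℕ) :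
    HasValue φ (poch x y k) (qPoch v w k) := by
  induction k with
  | zero => simpa [_root_.poch, qPoch] using hasValue_one
  | succ k ih =>
    simpa only [_root_.poch, qPoch, prod_range_succ] using
      ih.mul (hasValue_one.sub (hx.mul (hy.pow k)))

end HasValue

lemma exists_dvd_pow_mul_sub_aeval {P u : MvP} {h : Polynomial ℚ}
    (hP : P ∣ u * MvPolynomial.X 0 - Polynomial.aeval (MvPolynomial.X 1) h)
    {s : Polynomial ℚ} (hu : u = Polynomial.aeval (MvPolynomial.X 1) s) (f : MvP) :
    ∃ (d : ℕ) (g : Polynomial ℚ), P ∣ u ^ d * f - Polynomial.aeval (MvPolynomial.X 1) g := by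
  induction f using MvPolynomial.induction_on with
  | C c =>
    refine ⟨0, Polynomial.C c, ?_⟩
    simp [MvPolynomial.algebraMap_eq]
  | add f₁ f₂ h₁ h₂ =>
    obtain ⟨d₁, g₁, h₁⟩ := h₁
    obtain ⟨d₂, g₂, h₂⟩ := h₂
    refine ⟨d₁ + d₂, s ^ d₂ * g₁ + s ^ d₁ * g₂, ?_⟩
    have := (h₁.mul_left (u ^ d₂)).add (h₂.mul_left (u ^ d₁))
    convert this using 1
    simp only [map_add, map_mul, map_pow, ← hu]
    ring
  | mul_X f i hf =>
    obtain ⟨d, g, hd⟩ := hf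
    fin_cases i
    · refine ⟨d + 1, g * h, ?_⟩
      have := (hd.mul_right (u * MvPolynomial.X 0)).add
        (hP.mul_left (Polynomial.aeval (MvPolynomial.X 1) g))
      convert this using 1
      simp only [map_mul]
      simp
      ring
    · refine ⟨d, g * Polynomial.X, ?_⟩
      have := hd.mul_right (MvPolynomial.X 1)
      convert this using 1
      simp
      ring

lemma dvd_iff_map_eq_zero [Algebra ℚ K] (φ : MvP →ₐ[ℚ] K)
    (hφ : Transcendental ℚ (φ (MvPolynomial.X 1))) {P u : MvP} {h : Polynomial ℚ}
    (hP : P ∣ u * MvPolynomial.X 0 - Polynomial.aeval (MvPolynomial.X 1) h)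
    {s : Polynomial ℚ} (hu : u = Polynomial.aeval (MvPolynomial.X 1) s) (hcop : IsCoprime P u)
    (hP0 : φ P = 0) (f : MvP) : P ∣ f ↔ φ f = 0 := by
  refine ⟨?_, fun hf => ?_⟩
  · rintro ⟨g, rfl⟩
    rw [map_mul, hP0, zero_mul]
  · obtain ⟨d, g, hd⟩ := exists_dvd_pow_mul_sub_aeval hP hu f
    have hg : g = 0 := by
      obtain ⟨c, hc⟩ := hd
      have := congrArg φ hc
      rw [map_sub, map_mul, map_mul, hf, hP0, mul_zero, zero_mul, zero_sub, neg_eq_zero,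
        ← Polynomial.aeval_algHom_apply] at this
      exact transcendental_iff.1 hφ g this
    rw [hg, map_zero, sub_zero] at hd
    exact hcop.pow_right.dvd_of_dvd_mul_left hd

lemma prime_of_dvd_iff {P : MvP} (hP : P ≠ 0) (hdvd : ∀ f, P ∣ f ↔ φ f = 0) : Prime P := by
  refine ⟨hP, fun h => ?_, fun a b hab => ?_⟩
  · have := (hdvd 1).1 h.dvd
    simp at this
  · simpa [hdvd] using hab

/-- A rational function vanishing at a prime divisor has, in lowest terms, numerator divisible
by that prime and denominator not divisible by it. -/
lemma HasValue.dvd_num {P : MvP} (hP : Prime P) (hdvd : ∀ f, P ∣ f ↔ φ f = 0) {x : FF}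
    (hx : HasValue φ x 0) :
    P ∣ IsFractionRing.num MvP x ∧ IsRelPrime (IsFractionRing.den MvP x : MvP) P := by
  obtain ⟨N, D, hD, h, e⟩ := hx
  have hnd := IsFractionRing.mk'_num_den' MvP x
  have hden : algebraMap MvP FF (IsFractionRing.den MvP x : MvP) ≠ 0 := by
    rw [map_ne_zero_iff _ (IsFractionRing.injective MvP FF)]
    exact nonZeroDivisors.ne_zero (IsFractionRing.den MvP x).2
  have hmul : IsFractionRing.num MvP x * D = N * IsFractionRing.den MvP x := by
    apply IsFractionRing.injective MvP FF
    rw [map_mul, map_mul, ← h]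
    nth_rewrite 2 [← hnd]
    field_simp
  have hnum : P ∣ IsFractionRing.num MvP x := by
    have h1 : P ∣ IsFractionRing.num MvP x * D := by
      rw [hmul]
      exact ((hdvd N).2 (by rw [e, zero_mul])).mul_right _
    exact (hP.dvd_or_dvd h1).resolve_right fun h2 => hD ((hdvd D).1 h2)
  refine ⟨hnum, IsRelPrime.symm ?_⟩
  rw [hP.irreducible.isRelPrime_iff_not_dvd]
  exact fun h2 => hP.not_isUnit (IsFractionRing.num_den_reduced MvP x hnum h2)

lemma congrZero_mul {φ ψ : MvP →+* K} {P R : MvP} (hP : Prime P) (hR : Prime R)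
    (hdP : ∀ f, P ∣ f ↔ φ f = 0) (hdR : ∀ f, R ∣ f ↔ ψ f = 0) (hPR : φ R ≠ 0) {x : FF}
    (hφ : HasValue φ x 0) (hψ : HasValue ψ x 0) : CongrZero x (P * R) := by
  obtain ⟨h1, h2⟩ := hφ.dvd_num hP hdP
  obtain ⟨h3, h4⟩ := hψ.dvd_num hR hdR
  have hrel : IsRelPrime P R := by
    rw [hP.irreducible.isRelPrime_iff_not_dvd, hdP]
    exact hPR
  obtain ⟨B, hB⟩ := hrel.mul_dvd h1 h3
  refine ⟨B, IsFractionRing.den MvP x, nonZeroDivisors.ne_zero (IsFractionRing.den MvP x).2,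
    h2.mul_right h4, ?_⟩
  rw [← mul_div_assoc, ← map_mul, ← hB]
  exact (IsFractionRing.mk'_num_den' MvP x).symm

end Specialization

theorem stmt18 (r : ℕ) (hr : r ∈ ({1, 2, 4} : Set ℕ)) (n : ℕ) (hn : 0 < n)
    (hmod : n % 9 = (2 * r) % 9) :
    CongrZero
      (∑ k ∈ Finset.range n,
        poch (av ^ 5 * qv ^ r) (qv ^ 9) k * poch (qv ^ r * av ^ (-5 : ℤ)) (qv ^ 9) k
            * poch (qv ^ (9 - 2 * r)) (qv ^ 9) k * qv ^ (9 * k)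
          / (poch (av * qv ^ 9) (qv ^ 9) k * poch (qv ^ 9 * av ^ (-1 : ℤ)) (qv ^ 9) k
              * poch (qv ^ 9) (qv ^ 9) k))
      ((1 - MvPolynomial.X 0 * MvPolynomial.X 1 ^ n)
        * (MvPolynomial.X 0 - MvPolynomial.X 1 ^ n)) := by
  have hr' : r = 1 ∨ r = 2 ∨ r = 4 := by simpa using hr
  obtain ⟨L, hL⟩ : ∃ L, n = 9 * L + 2 * r := ⟨n / 9, by omega⟩
  set t : RatFunc ℚ := RatFunc.X
  have ht0 : t ≠ 0 := RatFunc.X_ne_zero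
  have htr : Transcendental ℚ t := by
    convert RatFunc.transcendental_X (K := ℚ)
    exact Subsingleton.elim _ _
  have htn : ∀ m : ℕ, t ^ m = 1 → m = 0 := by
    intro m hm
    by_contra h
    have h2 := transcendental_iff.1 htr (Polynomial.X ^ m - Polynomial.C 1) (by simp [hm])
    exact Polynomial.X_pow_sub_C_ne_zero (Nat.pos_of_ne_zero h) 1 h2
  have ht : ∀ z : ℤ, t ^ z = 1 → z = 0 := by
    intro z hz
    obtain ⟨m, rfl | rfl⟩ := z.eq_nat_or_neg
    · exact_mod_cast htn m (by simpa using hz)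
    · simpa using htn m (by simpa using hz)
  have key := sum_qPoch_specialized t ht ht0 r L n hr' hL
  have hne : ∀ z : ℤ, z ≠ 0 → ∀ x, x = t ^ z → x ≠ 1 := fun z hz x hx h => hz (ht z (hx ▸ h))
  have hvalue : ∀ α : RatFunc ℚ, α ≠ 0 → (∀ j : ℕ, α * t ^ 9 * (t ^ 9) ^ j ≠ 1) →
      (∀ j : ℕ, t ^ 9 * α⁻¹ * (t ^ 9) ^ j ≠ 1) →
      HasValue (MvPolynomial.aeval ![α, t] : MvP →ₐ[ℚ] RatFunc ℚ).toRingHom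
        (∑ k ∈ Finset.range n,
          poch (av ^ 5 * qv ^ r) (qv ^ 9) k * poch (qv ^ r * av ^ (-5 : ℤ)) (qv ^ 9) k
              * poch (qv ^ (9 - 2 * r)) (qv ^ 9) k * qv ^ (9 * k)
            / (poch (av * qv ^ 9) (qv ^ 9) k * poch (qv ^ 9 * av ^ (-1 : ℤ)) (qv ^ 9) k
                * poch (qv ^ 9) (qv ^ 9) k))
        (∑ k ∈ Finset.range n,
          qPoch (α ^ 5 * t ^ r) (t ^ 9) k * qPoch (t ^ r * (α ^ 5)⁻¹) (t ^ 9) k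
              * qPoch (t ^ (9 - 2 * r)) (t ^ 9) k * t ^ (9 * k)
            / (qPoch (α * t ^ 9) (t ^ 9) k * qPoch (t ^ 9 * α⁻¹) (t ^ 9) k
                * qPoch (t ^ 9) (t ^ 9) k)) := by
    intro α hα h1 h2
    set φ := (MvPolynomial.aeval ![α, t] : MvP →ₐ[ℚ] RatFunc ℚ).toRingHom with hφ
    have ha : HasValue φ av α := by
      simpa [hφ, av, qv] using hasValue_algebraMap (φ := φ) (MvPolynomial.X 0)
    have hq : HasValue φ qv t := by
      simpa [hφ, av, qv] using hasValue_algebraMap (φ := φ) (MvPolynomial.X 1)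
    have ha5 : HasValue φ (av ^ (-5 : ℤ)) (α ^ 5)⁻¹ := by
      have : (av ^ (-5 : ℤ)) = (av ^ 5)⁻¹ := by rw [zpow_neg]; norm_cast
      rw [this]
      exact (ha.pow 5).inv (pow_ne_zero _ hα)
    have ha1 : HasValue φ (av ^ (-1 : ℤ)) α⁻¹ := by
      rw [zpow_neg_one]
      exact ha.inv hα
    refine HasValue.sum (fun k => ?_) n
    have hq9 := hq.pow 9
    refine (((((ha.pow 5).mul (hq.pow r)).poch hq9 k).mul (((hq.pow r).mul ha5).poch hq9 k)).mul
      ((hq.pow _).poch hq9 k)).mul (hq.pow _) |>.div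
      ((((ha.mul hq9).poch hq9 k).mul ((hq9.mul ha1).poch hq9 k)).mul (hq9.poch hq9 k)) ?_
    refine mul_ne_zero (mul_ne_zero (qPoch_ne_zero h1 k) (qPoch_ne_zero h2 k))
      (qPoch_ne_zero (fun j => hne (9 + 9 * j) (by omega) _ ?_) k)
    rw [zpow_add₀ ht0, zpow_mul]
    norm_cast
  have hn1 : ∀ j : ℕ, t ^ n * t ^ 9 * (t ^ 9) ^ j ≠ 1 := fun j =>
    hne (n + 9 + 9 * j) (by omega) _ (by
      rw [zpow_add₀ ht0, zpow_add₀ ht0, zpow_mul]; norm_cast)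
  have hn2 : ∀ j : ℕ, t ^ 9 * (t ^ n)⁻¹ * (t ^ 9) ^ j ≠ 1 := fun j =>
    hne (9 - n + 9 * j) (by omega) _ (by
      rw [zpow_add₀ ht0, zpow_sub₀ ht0, zpow_mul, div_eq_mul_inv]; norm_cast)
  have hd1 : ∀ f : MvP, (1 - MvPolynomial.X 0 * MvPolynomial.X 1 ^ n) ∣ f ↔
      (MvPolynomial.aeval ![(t ^ n)⁻¹, t] : MvP →ₐ[ℚ] RatFunc ℚ).toRingHom f = 0 :=
    dvd_iff_map_eq_zero _ (by simpa using htr) (u := MvPolynomial.X 1 ^ n) (h := 1)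
      (s := Polynomial.X ^ n) ⟨-1, by simp; ring⟩ (by simp)
      ⟨1, MvPolynomial.X 0, by ring⟩ (by simp [ht0])
  have hd2 : ∀ f : MvP, (MvPolynomial.X 0 - MvPolynomial.X 1 ^ n) ∣ f ↔
      (MvPolynomial.aeval ![t ^ n, t] : MvP →ₐ[ℚ] RatFunc ℚ).toRingHom f = 0 :=
    dvd_iff_map_eq_zero _ (by simpa using htr) (u := 1) (h := Polynomial.X ^ n)
      (s := 1) ⟨1, by simp⟩ (by simp) isCoprime_one_right (by simp)
  have hPR : (MvPolynomial.aeval ![(t ^ n)⁻¹, t] : MvP →ₐ[ℚ] RatFunc ℚ).toRingHom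
      (MvPolynomial.X 0 - MvPolynomial.X 1 ^ n) ≠ 0 := by
    intro h
    have h : (t ^ n)⁻¹ - t ^ n = 0 := by simpa using h
    have h3 := htn (n + n) (by
      rw [pow_add]
      nth_rewrite 1 [← sub_eq_zero.1 h]
      exact inv_mul_cancel₀ (pow_ne_zero _ ht0))
    omega
  refine congrZero_mul (prime_of_dvd_iff ?_ hd1) (prime_of_dvd_iff ?_ hd2) hd1 hd2 hPR ?_ ?_
  · intro h
    have := congrArg (MvPolynomial.eval ![0, 0]) h
    simp at this
  · intro h
    rw [h] at hPR
    simp at hPR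
  · have h := hvalue (t ^ n)⁻¹ (inv_ne_zero (pow_ne_zero _ ht0))
      (fun j => by rw [mul_comm (t ^ n)⁻¹]; exact hn2 j)
      (fun j => by rw [inv_inv, mul_comm (t ^ 9) (t ^ n)]; exact hn1 j)
    convert h using 1
    rw [← key]
    refine sum_congr rfl fun k _ => ?_
    have e : (t ^ n) ^ 5 = t ^ (5 * n) := by rw [← pow_mul, mul_comm]
    rw [inv_pow, inv_inv, inv_inv, e, mul_comm (t ^ r), mul_comm (t ^ 9) (t ^ n),
      mul_comm (t ^ 9) (t ^ n)⁻¹, mul_comm (t ^ r)]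
    ring
  · have h := hvalue (t ^ n) (pow_ne_zero _ ht0) hn1 hn2
    have e : (t ^ n) ^ 5 = t ^ (5 * n) := by rw [← pow_mul, mul_comm]
    rw [e, key] at h
    exact h
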